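/- Let n ≥ 2 and let Y be an unbounded closed subset of ℝ^{n+1}. Then 𝔜(Y) is an algebra under pointwise multiplication: if ψ₁, ψ₂ ∈ 𝔜(Y) then ψ₁ψ₂ ∈ 𝔜(Y), and ‖ψ₁ψ₂‖_𝔜 ≤ ‖ψ₁‖_𝔜 ‖ψ₂‖_𝔜. -/

import Mathlib

/- Function spaces 𝔚, 𝔛, 𝔜′, 𝔜₀, 𝔜 on `Y × 𝕊ⁿ` from Bernstein–Wang,
"A mountain-pass theorem for asymptotically conical self-expanders". -/

noncomputable section

open Set Metric Real Filter
open scoped RealInnerProductSpace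

/-- `ℝ^{n+1}` as a Euclidean space. -/
abbrev Euc (n : ℕ) : Type := EuclideanSpace ℝ (Fin (n + 1))

/-- The unit sphere `𝕊ⁿ ⊆ ℝ^{n+1}`. -/
def Sph (n : ℕ) : Set (Euc n) := Metric.sphere (0 : Euc n) 1

/-- The set `Y × 𝕊ⁿ` inside `ℝ^{n+1} × ℝ^{n+1}`. -/
def pts {n : ℕ} (Y : Set (Euc n)) : Set (Euc n × Euc n) := Y ×ˢ Sph n

/-- The weight `(1+|p|)^{n+1} e^{|p|²/4}` appearing in the 𝔚-norm. -/
def wWeight (n : ℕ) (p : Euc n) : ℝ := (1 + ‖p‖) ^ (n + 1) * Real.exp (‖p‖ ^ 2 / 4)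

/-- The 𝔚-norm `sup (1+|p|)^{n+1} e^{|p|²/4} |ψ|` over `Y × 𝕊ⁿ`. -/
def WNorm {n : ℕ} (Y : Set (Euc n)) (ψ : Euc n × Euc n → ℝ) : ℝ :=
  sSup ((fun x => wWeight n x.1 * |ψ x|) '' pts Y)

/-- Membership in the space 𝔚(Y) of rapidly decaying continuous functions. -/
def memW {n : ℕ} (Y : Set (Euc n)) (ψ : Euc n × Euc n → ℝ) : Prop :=
  ContinuousOn ψ (pts Y) ∧ ∃ M : ℝ, ∀ x ∈ pts Y, wWeight n x.1 * |ψ x| ≤ M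

/-- Supremum norm over `Y × 𝕊ⁿ`. -/
def nsup {n : ℕ} {F : Type*} [NormedAddCommGroup F] (Y : Set (Euc n))
    (f : Euc n × Euc n → F) : ℝ :=
  sSup ((fun x => ‖f x‖) '' pts Y)

/-- The set of Lipschitz constants of `f` on `Y × 𝕊ⁿ` (with the metric induced from
`ℝ^{n+1} × ℝ^{n+1}`). -/
def lipSet {n : ℕ} {F : Type*} [NormedAddCommGroup F] (Y : Set (Euc n))
    (f : Euc n × Euc n → F) : Set ℝ :=
  {K : ℝ | 0 ≤ K ∧ ∀ x ∈ pts Y, ∀ y ∈ pts Y, ‖f x - f y‖ ≤ K * dist x y}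

/-- The Lipschitz norm `‖f‖_{Lip}`: sup norm plus best Lipschitz constant. -/
def LipNorm {n : ℕ} {F : Type*} [NormedAddCommGroup F] (Y : Set (Euc n))
    (f : Euc n × Euc n → F) : ℝ :=
  nsup Y f + sInf (lipSet Y f)

/-- `f` is bounded and Lipschitz on `Y × 𝕊ⁿ`. -/
def IsBddLip {n : ℕ} {F : Type*} [NormedAddCommGroup F] (Y : Set (Euc n))
    (f : Euc n × Euc n → F) : Prop :=
  (∃ M : ℝ, ∀ x ∈ pts Y, ‖f x‖ ≤ M) ∧ (lipSet Y f).Nonempty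

/-- `g` is the spherical gradient `∇_{𝕊ⁿ} ψ` on `Y × 𝕊ⁿ`: at each `(p,v) ∈ Y × 𝕊ⁿ`,
`g(p,v)` is orthogonal to `v` and is the gradient of `ψ(p,·)` at `v` along the sphere. -/
def IsSphereGrad {n : ℕ} (Y : Set (Euc n)) (ψ : Euc n × Euc n → ℝ)
    (g : Euc n × Euc n → Euc n) : Prop :=
  ∀ x ∈ pts Y,
    ⟪g x, x.2⟫ = 0 ∧
    HasFDerivWithinAt (fun v => ψ (x.1, v)) (innerSL ℝ (g x)) (Sph n) x.2

/-- The weighted gradient supremum `sup (1+|p|)|∇_{𝕊ⁿ}ψ|`. -/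
def gradWsup {n : ℕ} (Y : Set (Euc n)) (g : Euc n × Euc n → Euc n) : ℝ :=
  sSup ((fun x => (1 + ‖x.1‖) * ‖g x‖) '' pts Y)

/-- Membership in the space 𝔛(Y). -/
def memX {n : ℕ} (Y : Set (Euc n)) (ψ : Euc n × Euc n → ℝ) : Prop :=
  IsBddLip Y ψ ∧ ∃ g : Euc n × Euc n → Euc n, IsSphereGrad Y ψ g ∧ IsBddLip Y g ∧
    ∃ M : ℝ, ∀ x ∈ pts Y, (1 + ‖x.1‖) * ‖g x‖ ≤ M

/-- The 𝔛-norm `‖ψ‖_𝔛 = ‖ψ‖_{Lip} + ‖∇_{𝕊ⁿ}ψ‖_{Lip} + sup (1+|p|)|∇_{𝕊ⁿ}ψ|`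
(as an infimum over representatives of the spherical gradient). -/
def XNorm {n : ℕ} (Y : Set (Euc n)) (ψ : Euc n × Euc n → ℝ) : ℝ :=
  sInf {r : ℝ | ∃ g : Euc n × Euc n → Euc n, IsSphereGrad Y ψ g ∧
    r = LipNorm Y ψ + LipNorm Y g + gradWsup Y g}

/-- Membership in `𝔜′(Y) = 𝔛(Y) + 𝔚(Y)` (equality of functions on `Y × 𝕊ⁿ`). -/
def memYp {n : ℕ} (Y : Set (Euc n)) (ψ : Euc n × Euc n → ℝ) : Prop :=
  ∃ ζ ξ : Euc n × Euc n → ℝ, memX Y ζ ∧ memW Y ξ ∧ ∀ x ∈ pts Y, ψ x = ζ x + ξ x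

/-- The 𝔜-norm `‖ψ‖_𝔜 = inf {‖ζ‖_𝔛 + ‖ξ‖_𝔚 : ψ = ζ + ξ}`. -/
def YNorm {n : ℕ} (Y : Set (Euc n)) (ψ : Euc n × Euc n → ℝ) : ℝ :=
  sInf {r : ℝ | ∃ ζ ξ : Euc n × Euc n → ℝ, memX Y ζ ∧ memW Y ξ ∧
    (∀ x ∈ pts Y, ψ x = ζ x + ξ x) ∧ r = XNorm Y ζ + WNorm Y ξ}

/-- Continuous compactly supported functions on `Y × 𝕊ⁿ`. -/
def memCc {n : ℕ} (Y : Set (Euc n)) (φ : Euc n × Euc n → ℝ) : Prop :=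
  ContinuousOn φ (pts Y) ∧
    ∃ K : Set (Euc n × Euc n), IsCompact K ∧ ∀ x ∈ pts Y, x ∉ K → φ x = 0

/-- Membership in `𝔜₀(Y)`: the closure of `C⁰_c(Y × 𝕊ⁿ)` in `𝔜′(Y)`. -/
def memY0 {n : ℕ} (Y : Set (Euc n)) (ψ : Euc n × Euc n → ℝ) : Prop :=
  memYp Y ψ ∧ ∀ ε : ℝ, 0 < ε → ∃ φ, memCc Y φ ∧ YNorm Y (fun x => ψ x - φ x) < ε

/-- Membership in `𝔜(Y) = ℝ·𝟙 ⊕ 𝔜₀(Y)`. -/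
def memY {n : ℕ} (Y : Set (Euc n)) (ψ : Euc n × Euc n → ℝ) : Prop :=
  ∃ (c : ℝ) (φ : Euc n × Euc n → ℝ), memY0 Y φ ∧ ∀ x ∈ pts Y, ψ x = c + φ x

/-- Quantitative membership in 𝔛. -/
def XB {n : ℕ} (Y : Set (Euc n)) (ζ : Euc n × Euc n → ℝ) (r : ℝ) : Prop :=
  ∃ (g : Euc n × Euc n → Euc n) (a b c d e : ℝ),
    (0 ≤ a ∧ 0 ≤ b ∧ 0 ≤ c ∧ 0 ≤ d ∧ 0 ≤ e) ∧ a + b + (c + d) + e ≤ r ∧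
    (∀ x ∈ pts Y, ‖ζ x‖ ≤ a) ∧
    (∀ x ∈ pts Y, ∀ y ∈ pts Y, ‖ζ x - ζ y‖ ≤ b * dist x y) ∧
    IsSphereGrad Y ζ g ∧
    (∀ x ∈ pts Y, ‖g x‖ ≤ c) ∧
    (∀ x ∈ pts Y, ∀ y ∈ pts Y, ‖g x - g y‖ ≤ d * dist x y) ∧
    (∀ x ∈ pts Y, (1 + ‖x.1‖) * ‖g x‖ ≤ e)

/-- Quantitative membership in 𝔚. -/
def WB {n : ℕ} (Y : Set (Euc n)) (ξ : Euc n × Euc n → ℝ) (r : ℝ) : Prop :=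
  ContinuousOn ξ (pts Y) ∧ 0 ≤ r ∧ ∀ x ∈ pts Y, wWeight n x.1 * |ξ x| ≤ r

/-- Quantitative membership in 𝔜′. -/
def YB {n : ℕ} (Y : Set (Euc n)) (ψ : Euc n × Euc n → ℝ) (r : ℝ) : Prop :=
  ∃ (ζ ξ : Euc n × Euc n → ℝ) (s t : ℝ), XB Y ζ s ∧ WB Y ξ t ∧
    (∀ x ∈ pts Y, ψ x = ζ x + ξ x) ∧ s + t ≤ r

lemma nsup_nonneg' {n : ℕ} {F : Type*} [NormedAddCommGroup F] (Y : Set (Euc n))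
    (f : Euc n × Euc n → F) : 0 ≤ nsup Y f := by
  apply Real.sSup_nonneg
  rintro _ ⟨x, _, rfl⟩
  exact norm_nonneg _

lemma lipInf_nonneg {n : ℕ} {F : Type*} [NormedAddCommGroup F] (Y : Set (Euc n))
    (f : Euc n × Euc n → F) : 0 ≤ sInf (lipSet Y f) :=
  Real.sInf_nonneg fun _ h => h.1

lemma gradWsup_nonneg' {n : ℕ} (Y : Set (Euc n))
    (f : Euc n × Euc n → Euc n) : 0 ≤ gradWsup Y f := by
  apply Real.sSup_nonneg
  rintro _ ⟨x, _, rfl⟩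
  positivity

lemma wWeight_one_le {n : ℕ} (p : Euc n) : 1 ≤ wWeight n p := by
  unfold wWeight
  have h1 : (1:ℝ) ≤ (1 + ‖p‖) ^ (n + 1) := one_le_pow₀ (by linarith [norm_nonneg p])
  have h2 : (1:ℝ) ≤ Real.exp (‖p‖ ^ 2 / 4) := Real.one_le_exp (by positivity)
  nlinarith

lemma WNorm_nonneg' {n : ℕ} (Y : Set (Euc n))
    (f : Euc n × Euc n → ℝ) : 0 ≤ WNorm Y f := by
  apply Real.sSup_nonneg
  rintro _ ⟨x, _, rfl⟩
  have := wWeight_one_le x.1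
  positivity

lemma XNorm_set_nonneg {n : ℕ} (Y : Set (Euc n)) (ψ : Euc n × Euc n → ℝ) (r : ℝ)
    (h : ∃ g : Euc n × Euc n → Euc n, IsSphereGrad Y ψ g ∧
      r = LipNorm Y ψ + LipNorm Y g + gradWsup Y g) : 0 ≤ r := by
  obtain ⟨g, _, rfl⟩ := h
  unfold LipNorm
  have := nsup_nonneg' Y ψ
  have := nsup_nonneg' Y g
  have := lipInf_nonneg Y ψ
  have := lipInf_nonneg Y g
  have := gradWsup_nonneg' Y g
  positivity

lemma XNorm_nonneg' {n : ℕ} (Y : Set (Euc n))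
    (f : Euc n × Euc n → ℝ) : 0 ≤ XNorm Y f :=
  Real.sInf_nonneg fun r h => XNorm_set_nonneg Y f r h

lemma YNorm_set_nonneg {n : ℕ} (Y : Set (Euc n)) (ψ : Euc n × Euc n → ℝ) (r : ℝ)
    (h : ∃ ζ ξ : Euc n × Euc n → ℝ, memX Y ζ ∧ memW Y ξ ∧
    (∀ x ∈ pts Y, ψ x = ζ x + ξ x) ∧ r = XNorm Y ζ + WNorm Y ξ) : 0 ≤ r := by
  obtain ⟨ζ, ξ, _, _, _, rfl⟩ := h
  have := XNorm_nonneg' Y ζ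
  have := WNorm_nonneg' Y ξ
  positivity

lemma YNorm_nonneg' {n : ℕ} (Y : Set (Euc n))
    (f : Euc n × Euc n → ℝ) : 0 ≤ YNorm Y f :=
  Real.sInf_nonneg fun r h => YNorm_set_nonneg Y f r h

lemma XB.memX {n : ℕ} {Y : Set (Euc n)} {ζ : Euc n × Euc n → ℝ} {r : ℝ}
    (h : XB Y ζ r) : memX Y ζ := by
  obtain ⟨g, a, b, c, d, e, ⟨ha, hb, hc, hd, he⟩, -, h1, h2, h3, h4, h5, h6⟩ := h
  exact ⟨⟨⟨a, h1⟩, ⟨b, hb, h2⟩⟩, g, h3, ⟨⟨c, h4⟩, ⟨d, hd, h5⟩⟩, e, h6⟩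

lemma nsup_le' {n : ℕ} {F : Type*} [NormedAddCommGroup F] {Y : Set (Euc n)}
    {f : Euc n × Euc n → F} {a : ℝ} (ha : 0 ≤ a) (h : ∀ x ∈ pts Y, ‖f x‖ ≤ a) :
    nsup Y f ≤ a := by
  apply Real.sSup_le _ ha
  rintro _ ⟨x, hx, rfl⟩
  exact h x hx

lemma lipInf_le' {n : ℕ} {F : Type*} [NormedAddCommGroup F] {Y : Set (Euc n)}
    {f : Euc n × Euc n → F} {a : ℝ} (ha : 0 ≤ a)
    (h : ∀ x ∈ pts Y, ∀ y ∈ pts Y, ‖f x - f y‖ ≤ a * dist x y) :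
    sInf (lipSet Y f) ≤ a :=
  csInf_le ⟨0, fun _ h => h.1⟩ ⟨ha, h⟩

lemma XB.XNorm_le {n : ℕ} {Y : Set (Euc n)} {ζ : Euc n × Euc n → ℝ} {r : ℝ}
    (h : XB Y ζ r) : XNorm Y ζ ≤ r := by
  obtain ⟨g, a, b, c, d, e, ⟨ha, hb, hc, hd, he⟩, hr, h1, h2, h3, h4, h5, h6⟩ := h
  refine le_trans (csInf_le ⟨0, fun r h => XNorm_set_nonneg Y ζ r h⟩ ⟨g, h3, rfl⟩) ?_
  have h7 : gradWsup Y g ≤ e := by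
    apply Real.sSup_le _ he
    rintro _ ⟨x, hx, rfl⟩
    exact h6 x hx
  have := nsup_le' ha h1
  have := nsup_le' hc h4
  have := lipInf_le' hb h2
  have := lipInf_le' hd h5
  unfold LipNorm
  linarith

lemma le_nsup {n : ℕ} {F : Type*} [NormedAddCommGroup F] {Y : Set (Euc n)}
    {f : Euc n × Euc n → F} (h : ∃ M, ∀ x ∈ pts Y, ‖f x‖ ≤ M) :
    ∀ x ∈ pts Y, ‖f x‖ ≤ nsup Y f := by
  intro x hx
  obtain ⟨M, hM⟩ := h
  refine le_csSup ⟨M, ?_⟩ ⟨x, hx, rfl⟩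
  rintro _ ⟨y, hy, rfl⟩
  exact hM y hy

lemma le_lipInf {n : ℕ} {F : Type*} [NormedAddCommGroup F] {Y : Set (Euc n)}
    {f : Euc n × Euc n → F} (h : (lipSet Y f).Nonempty) :
    ∀ x ∈ pts Y, ∀ y ∈ pts Y, ‖f x - f y‖ ≤ sInf (lipSet Y f) * dist x y := by
  intro x hx y hy
  by_cases hxy : x = y
  · simp [hxy]
  · have hd : 0 < dist x y := dist_pos.2 hxy
    rw [← div_le_iff₀ hd]
    apply le_csInf h
    rintro K ⟨_, hK⟩
    rw [div_le_iff₀ hd]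
    exact hK x hx y hy

lemma grad_unique {n : ℕ} {Y : Set (Euc n)} {ψ : Euc n × Euc n → ℝ}
    {g g' : Euc n × Euc n → Euc n} (h : IsSphereGrad Y ψ g) (h' : IsSphereGrad Y ψ g') :
    ∀ x ∈ pts Y, g x = g' x := by
  intro x hx
  obtain ⟨o, H⟩ := h x hx
  obtain ⟨o', H'⟩ := h' x hx
  have hv : ‖x.2‖ = 1 := by simpa [Sph] using hx.2
  by_contra hne
  have hu0 : g x - g' x ≠ 0 := sub_ne_zero.2 hne
  set u := g x - g' x with hu
  set w := (‖u‖)⁻¹ • u with hw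
  have hupos : 0 < ‖u‖ := norm_pos_iff.2 hu0
  have hwn : ‖w‖ = 1 := by
    rw [hw, norm_smul, norm_inv, norm_norm, inv_mul_cancel₀ hupos.ne']
  have hwo : ⟪w, x.2⟫ = 0 := by
    rw [hw, real_inner_smul_left, hu, inner_sub_left, o, o']; simp
  let γ : ℝ → Euc n := fun t => Real.cos t • x.2 + Real.sin t • w
  have γ0 : γ 0 = x.2 := by simp [γ]
  have hγ : HasDerivAt γ w 0 := by
    have h1 := ((Real.hasDerivAt_cos 0).smul_const x.2).add
      ((Real.hasDerivAt_sin 0).smul_const w)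
    have h2 : -Real.sin 0 • x.2 + Real.cos 0 • w = w := by simp
    rw [h2] at h1
    exact h1
  have hγS : ∀ t, γ t ∈ Sph n := by
    intro t
    have hwo' : ⟪x.2, w⟫ = 0 := by rw [real_inner_comm]; exact hwo
    have : ‖γ t‖ ^ 2 = 1 := by
      rw [← real_inner_self_eq_norm_sq]
      simp only [γ, inner_add_left, inner_add_right, real_inner_smul_left,
        real_inner_smul_right, hwo, hwo', real_inner_self_eq_norm_sq, norm_smul, hv, hwn, mul_one,
        Real.norm_eq_abs, sq_abs]
      have := Real.sin_sq_add_cos_sq t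
      linarith
    have : ‖γ t‖ = 1 := by
      have h0 := norm_nonneg (γ t)
      nlinarith
    simpa [Sph] using this
  have d1 := HasFDerivWithinAt.comp_hasDerivAt_of_eq (x := 0) H hγ
    (Eventually.of_forall hγS) γ0.symm
  have d2 := HasFDerivWithinAt.comp_hasDerivAt_of_eq (x := 0) H' hγ
    (Eventually.of_forall hγS) γ0.symm
  have := d1.unique d2
  simp only [innerSL_apply_apply] at this
  have h3 : ⟪u, w⟫ = 0 := by rw [hu, inner_sub_left, this, sub_self]
  rw [hw, real_inner_smul_right, real_inner_self_eq_norm_sq] at h3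
  have : ‖u‖⁻¹ * ‖u‖ ^ 2 > 0 := by positivity
  linarith

lemma memX.XB {n : ℕ} {Y : Set (Euc n)} {ζ : Euc n × Euc n → ℝ}
    (h : memX Y ζ) : XB Y ζ (XNorm Y ζ) := by
  obtain ⟨⟨h1, h2⟩, g, h3, ⟨h4, h5⟩, h6⟩ := h
  refine ⟨g, nsup Y ζ, sInf (lipSet Y ζ), nsup Y g, sInf (lipSet Y g), gradWsup Y g,
    ⟨nsup_nonneg' _ _, lipInf_nonneg _ _, nsup_nonneg' _ _, lipInf_nonneg _ _,
      gradWsup_nonneg' _ _⟩, ?_, le_nsup h1, le_lipInf h2, h3, le_nsup h4, le_lipInf h5, ?_⟩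
  · refine le_csInf ⟨_, g, h3, rfl⟩ ?_
    rintro _ ⟨g', hg', rfl⟩
    have heq := grad_unique h3 hg'
    have e1 : nsup Y g = nsup Y g' := by
      unfold nsup
      congr 1
      exact Set.image_congr fun x hx => by rw [heq x hx]
    have e2 : lipSet Y g = lipSet Y g' := by
      unfold lipSet
      ext K
      constructor
      · rintro ⟨a, b⟩
        exact ⟨a, fun x hx y hy => by rw [← heq x hx, ← heq y hy]; exact b x hx y hy⟩
      · rintro ⟨a, b⟩
        exact ⟨a, fun x hx y hy => by rw [heq x hx, heq y hy]; exact b x hx y hy⟩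
    have e3 : gradWsup Y g = gradWsup Y g' := by
      unfold gradWsup
      congr 1
      exact Set.image_congr fun x hx => by rw [heq x hx]
    rw [e1, e2, e3]
    unfold LipNorm
    exact le_rfl
  · intro x hx
    obtain ⟨M, hM⟩ := h6
    refine le_csSup ⟨M, ?_⟩ ⟨x, hx, rfl⟩
    rintro _ ⟨y, hy, rfl⟩
    exact hM y hy

lemma WB.memW {n : ℕ} {Y : Set (Euc n)} {ζ : Euc n × Euc n → ℝ} {r : ℝ}
    (h : WB Y ζ r) : memW Y ζ := ⟨h.1, r, h.2.2⟩

lemma WB.WNorm_le {n : ℕ} {Y : Set (Euc n)} {ζ : Euc n × Euc n → ℝ} {r : ℝ}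
    (h : WB Y ζ r) : WNorm Y ζ ≤ r := by
  apply Real.sSup_le _ h.2.1
  rintro _ ⟨x, hx, rfl⟩
  exact h.2.2 x hx

lemma memW.WB {n : ℕ} {Y : Set (Euc n)} {ζ : Euc n × Euc n → ℝ}
    (h : memW Y ζ) : WB Y ζ (WNorm Y ζ) := by
  refine ⟨h.1, WNorm_nonneg' _ _, fun x hx => ?_⟩
  obtain ⟨M, hM⟩ := h.2
  refine le_csSup ⟨M, ?_⟩ ⟨x, hx, rfl⟩
  rintro _ ⟨y, hy, rfl⟩
  exact hM y hy

lemma YB.memYp {n : ℕ} {Y : Set (Euc n)} {ψ : Euc n × Euc n → ℝ} {r : ℝ}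
    (h : YB Y ψ r) : memYp Y ψ := by
  obtain ⟨ζ, ξ, s, t, h1, h2, h3, _⟩ := h
  exact ⟨ζ, ξ, h1.memX, h2.memW, h3⟩

lemma YB.YNorm_le {n : ℕ} {Y : Set (Euc n)} {ψ : Euc n × Euc n → ℝ} {r : ℝ}
    (h : YB Y ψ r) : YNorm Y ψ ≤ r := by
  obtain ⟨ζ, ξ, s, t, h1, h2, h3, h4⟩ := h
  refine le_trans (csInf_le ⟨0, fun r h => YNorm_set_nonneg Y ψ r h⟩
    ⟨ζ, ξ, h1.memX, h2.memW, h3, rfl⟩) ?_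
  linarith [h1.XNorm_le, h2.WNorm_le]

lemma memYp.YB {n : ℕ} {Y : Set (Euc n)} {ψ : Euc n × Euc n → ℝ} {r : ℝ}
    (h : memYp Y ψ) (hr : YNorm Y ψ < r) : YB Y ψ r := by
  obtain ⟨ζ, ξ, h1, h2, h3⟩ := h
  obtain ⟨_, ⟨ζ', ξ', h1', h2', h3', rfl⟩, hlt⟩ :=
    exists_lt_of_csInf_lt (s := {r : ℝ | ∃ ζ ξ : Euc n × Euc n → ℝ, memX Y ζ ∧ memW Y ξ ∧
      (∀ x ∈ pts Y, ψ x = ζ x + ξ x) ∧ r = XNorm Y ζ + WNorm Y ξ})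
      ⟨_, ζ, ξ, h1, h2, h3, rfl⟩ hr
  exact ⟨ζ', ξ', _, _, h1'.XB, h2'.WB, h3', hlt.le⟩

lemma YB.congr' {n : ℕ} {Y : Set (Euc n)} {ψ ψ' : Euc n × Euc n → ℝ} {r : ℝ}
    (h : YB Y ψ r) (he : ∀ x ∈ pts Y, ψ' x = ψ x) : YB Y ψ' r := by
  obtain ⟨ζ, ξ, s, t, h1, h2, h3, h4⟩ := h
  exact ⟨ζ, ξ, s, t, h1, h2, fun x hx => (he x hx).trans (h3 x hx), h4⟩

lemma XB.add' {n : ℕ} {Y : Set (Euc n)} {ζ ζ' : Euc n × Euc n → ℝ} {r r' : ℝ}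
    (h : XB Y ζ r) (h' : XB Y ζ' r') : XB Y (fun x => ζ x + ζ' x) (r + r') := by
  obtain ⟨g, a, b, c, d, e, ⟨ha, hb, hc, hd, he⟩, hr, h1, h2, h3, h4, h5, h6⟩ := h
  obtain ⟨g', a', b', c', d', e', ⟨ha', hb', hc', hd', he'⟩, hr', h1', h2', h3', h4', h5', h6'⟩ := h'
  refine ⟨fun x => g x + g' x, a + a', b + b', c + c', d + d', e + e',
    ⟨by positivity, by positivity, by positivity, by positivity, by positivity⟩,
    by linarith, ?_, ?_, ?_, ?_, ?_, ?_⟩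
  · intro x hx
    exact (norm_add_le _ _).trans (add_le_add (h1 x hx) (h1' x hx))
  · intro x hx y hy
    have : ζ x + ζ' x - (ζ y + ζ' y) = (ζ x - ζ y) + (ζ' x - ζ' y) := by ring
    rw [this, add_mul]
    exact (norm_add_le _ _).trans (add_le_add (h2 x hx y hy) (h2' x hx y hy))
  · intro x hx
    refine ⟨by rw [inner_add_left, (h3 x hx).1, (h3' x hx).1, add_zero], ?_⟩
    rw [map_add]
    exact (h3 x hx).2.add (h3' x hx).2
  · intro x hx
    exact (norm_add_le _ _).trans (add_le_add (h4 x hx) (h4' x hx))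
  · intro x hx y hy
    have : g x + g' x - (g y + g' y) = (g x - g y) + (g' x - g' y) := by abel
    rw [this, add_mul]
    exact (norm_add_le _ _).trans (add_le_add (h5 x hx y hy) (h5' x hx y hy))
  · intro x hx
    have := norm_add_le (g x) (g' x)
    have h0 : 0 ≤ 1 + ‖x.1‖ := by positivity
    calc (1 + ‖x.1‖) * ‖g x + g' x‖ ≤ (1 + ‖x.1‖) * (‖g x‖ + ‖g' x‖) := by gcongr
      _ ≤ e + e' := by linarith [h6 x hx, h6' x hx]

lemma smul_lip {E : Type*} [NormedAddCommGroup E] [NormedSpace ℝ E]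
    {s t : ℝ} {u v : E} {a b c d δ : ℝ} (h1 : ‖s‖ ≤ a) (h2 : ‖s - t‖ ≤ b * δ)
    (h3 : ‖v‖ ≤ c) (h4 : ‖u - v‖ ≤ d * δ) :
    ‖s • u - t • v‖ ≤ (a * d + b * c) * δ := by
  have : s • u - t • v = s • (u - v) + (s - t) • v := by
    rw [smul_sub, sub_smul]; abel
  rw [this]
  refine (norm_add_le _ _).trans ?_
  rw [norm_smul, norm_smul]
  have e1 : ‖s‖ * ‖u - v‖ ≤ a * (d * δ) :=
    mul_le_mul h1 h4 (norm_nonneg _) ((norm_nonneg _).trans h1)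
  have e2 : ‖s - t‖ * ‖v‖ ≤ (b * δ) * c :=
    mul_le_mul h2 h3 (norm_nonneg _) ((norm_nonneg _).trans h2)
  linarith

lemma XB.mul' {n : ℕ} {Y : Set (Euc n)} {ζ ζ' : Euc n × Euc n → ℝ} {r r' : ℝ}
    (h : XB Y ζ r) (h' : XB Y ζ' r') : XB Y (fun x => ζ x * ζ' x) (r * r') := by
  obtain ⟨g, a, b, c, d, e, ⟨ha, hb, hc, hd, he⟩, hr, h1, h2, h3, h4, h5, h6⟩ := h
  obtain ⟨g', a', b', c', d', e', ⟨ha', hb', hc', hd', he'⟩, hr', h1', h2', h3', h4', h5', h6'⟩ := h'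
  refine ⟨fun x => ζ x • g' x + ζ' x • g x, a * a', a * b' + b * a', a * c' + a' * c,
    (a * d' + b * c') + (a' * d + b' * c), a * e' + a' * e,
    ⟨by positivity, by positivity, by positivity, by positivity, by positivity⟩,
    ?_, ?_, ?_, ?_, ?_, ?_, ?_⟩
  · have : (a + b + (c + d) + e) * (a' + b' + (c' + d') + e') ≤ r * r' :=
      mul_le_mul hr hr' (by positivity) (le_trans (by positivity) hr)
    refine le_trans ?_ this
    have : 0 ≤ b * b' + b * d' + b * e' + c * b' * 0 + b' * d + b' * e
      + (c + d + e) * (c' + d' + e') := by positivity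
    nlinarith
  · intro x hx
    rw [norm_mul]
    exact mul_le_mul (h1 x hx) (h1' x hx) (norm_nonneg _) ha
  · intro x hx y hy
    exact smul_lip (h1 x hx) (h2 x hx y hy) (h1' y hy) (h2' x hx y hy)
  · intro x hx
    refine ⟨by rw [inner_add_left, real_inner_smul_left, real_inner_smul_left,
      (h3 x hx).1, (h3' x hx).1]; simp, ?_⟩
    rw [map_add, map_smul, map_smul]
    exact (h3 x hx).2.mul (h3' x hx).2
  · intro x hx
    refine (norm_add_le _ _).trans ?_
    rw [norm_smul, norm_smul]
    exact add_le_add (mul_le_mul (h1 x hx) (h4' x hx) (norm_nonneg _) ha)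
      (mul_le_mul (h1' x hx) (h4 x hx) (norm_nonneg _) ha')
  · intro x hx y hy
    have e1 := smul_lip (h1 x hx) (h2 x hx y hy) (h4' y hy) (h5' x hx y hy)
    have e2 := smul_lip (h1' x hx) (h2' x hx y hy) (h4 y hy) (h5 x hx y hy)
    have : ζ x • g' x + ζ' x • g x - (ζ y • g' y + ζ' y • g y)
      = (ζ x • g' x - ζ y • g' y) + (ζ' x • g x - ζ' y • g y) := by abel
    rw [this]
    refine (norm_add_le _ _).trans ?_
    linarith
  · intro x hx
    have h0 : 0 ≤ 1 + ‖x.1‖ := by positivity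
    have e0 : ‖ζ x • g' x + ζ' x • g x‖ ≤ ‖ζ x‖ * ‖g' x‖ + ‖ζ' x‖ * ‖g x‖ := by
      refine (norm_add_le _ _).trans ?_
      rw [norm_smul, norm_smul]
    have e1 := mul_le_mul (h1 x hx) (h6' x hx) (by positivity) ha
    have e2 := mul_le_mul (h1' x hx) (h6 x hx) (by positivity) ha'
    calc (1 + ‖x.1‖) * ‖ζ x • g' x + ζ' x • g x‖
        ≤ (1 + ‖x.1‖) * (‖ζ x‖ * ‖g' x‖ + ‖ζ' x‖ * ‖g x‖) := by gcongr
      _ ≤ a * e' + a' * e := by linarith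

lemma XB.bound {n : ℕ} {Y : Set (Euc n)} {ζ : Euc n × Euc n → ℝ} {r : ℝ}
    (h : XB Y ζ r) : 0 ≤ r ∧ (∀ x ∈ pts Y, |ζ x| ≤ r) ∧ ContinuousOn ζ (pts Y) := by
  obtain ⟨g, a, b, c, d, e, ⟨ha, hb, hc, hd, he⟩, hr, h1, h2, h3, h4, h5, h6⟩ := h
  refine ⟨by linarith, fun x hx => (h1 x hx).trans (by linarith), ?_⟩
  have : LipschitzOnWith ⟨b, hb⟩ ζ (pts Y) :=
    LipschitzOnWith.of_dist_le_mul fun x hx y hy => by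
      rw [dist_eq_norm]; exact h2 x hx y hy
  exact this.continuousOn

lemma WB.add' {n : ℕ} {Y : Set (Euc n)} {ζ ζ' : Euc n × Euc n → ℝ} {r r' : ℝ}
    (h : WB Y ζ r) (h' : WB Y ζ' r') : WB Y (fun x => ζ x + ζ' x) (r + r') := by
  obtain ⟨h1, h2, h3⟩ := h
  obtain ⟨h1', h2', h3'⟩ := h'
  refine ⟨h1.add h1', by positivity, fun x hx => ?_⟩
  have := wWeight_one_le x.1
  have e0 := abs_add_le (ζ x) (ζ' x)
  calc wWeight n x.1 * |ζ x + ζ' x| ≤ wWeight n x.1 * (|ζ x| + |ζ' x|) := by gcongr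
    _ ≤ _ := by linarith [h3 x hx, h3' x hx]

lemma WB.mulB {n : ℕ} {Y : Set (Euc n)} {ζ ζ' : Euc n × Euc n → ℝ} {r r' : ℝ}
    (h : WB Y ζ r) (h' : 0 ≤ r' ∧ (∀ x ∈ pts Y, |ζ' x| ≤ r') ∧ ContinuousOn ζ' (pts Y)) :
    WB Y (fun x => ζ x * ζ' x) (r * r') := by
  obtain ⟨h1, h2, h3⟩ := h
  obtain ⟨h1', h2', h3'⟩ := h'
  refine ⟨h1.mul h3', by positivity, fun x hx => ?_⟩
  rw [abs_mul, ← mul_assoc]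
  exact mul_le_mul (h3 x hx) (h2' x hx) (abs_nonneg _) h2

lemma WB.bound {n : ℕ} {Y : Set (Euc n)} {ζ : Euc n × Euc n → ℝ} {r : ℝ}
    (h : WB Y ζ r) : 0 ≤ r ∧ (∀ x ∈ pts Y, |ζ x| ≤ r) ∧ ContinuousOn ζ (pts Y) := by
  refine ⟨h.2.1, fun x hx => ?_, h.1⟩
  have := wWeight_one_le x.1
  have := h.2.2 x hx
  nlinarith [abs_nonneg (ζ x)]

lemma YB.add' {n : ℕ} {Y : Set (Euc n)} {ζ ζ' : Euc n × Euc n → ℝ} {r r' : ℝ}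
    (h : YB Y ζ r) (h' : YB Y ζ' r') : YB Y (fun x => ζ x + ζ' x) (r + r') := by
  obtain ⟨a, b, s, t, h1, h2, h3, h4⟩ := h
  obtain ⟨a', b', s', t', h1', h2', h3', h4'⟩ := h'
  exact ⟨_, _, _, _, h1.add' h1', h2.add' h2',
    fun x hx => by simp only [h3 x hx, h3' x hx]; ring, by linarith⟩

lemma YB.mul' {n : ℕ} {Y : Set (Euc n)} {ζ ζ' : Euc n × Euc n → ℝ} {r r' : ℝ}
    (h : YB Y ζ r) (h' : YB Y ζ' r') : YB Y (fun x => ζ x * ζ' x) (r * r') := by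
  obtain ⟨a, b, s, t, h1, h2, h3, h4⟩ := h
  obtain ⟨a', b', s', t', h1', h2', h3', h4'⟩ := h'
  refine ⟨_, _, _, _, h1.mul' h1',
    ((h2.mulB h1'.bound).add' (h2'.mulB h1.bound)).add' (h2.mulB h2'.bound),
    fun x hx => by simp only [h3 x hx, h3' x hx]; ring, ?_⟩
  have := h1.bound.1
  have := h2.bound.1
  have := h1'.bound.1
  have := h2'.bound.1
  have : (s + t) * (s' + t') ≤ r * r' :=
    mul_le_mul h4 h4' (by positivity) (le_trans (by positivity) h4)
  linarith

lemma memYp.continuousOn {n : ℕ} {Y : Set (Euc n)} {ψ : Euc n × Euc n → ℝ}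
    (h : memYp Y ψ) : ContinuousOn ψ (pts Y) := by
  obtain ⟨a, b, h1, h2, h3⟩ := h
  exact (h1.XB.bound.2.2.add h2.1).congr h3

lemma memYp.mul' {n : ℕ} {Y : Set (Euc n)} {ψ φ : Euc n × Euc n → ℝ}
    (h : memYp Y ψ) (h' : memYp Y φ) : memYp Y (fun x => ψ x * φ x) :=
  ((h.YB (lt_add_one _)).mul' (h'.YB (lt_add_one _))).memYp

lemma memYp.add' {n : ℕ} {Y : Set (Euc n)} {ψ φ : Euc n × Euc n → ℝ}
    (h : memYp Y ψ) (h' : memYp Y φ) : memYp Y (fun x => ψ x + φ x) :=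
  ((h.YB (lt_add_one _)).add' (h'.YB (lt_add_one _))).memYp

lemma YB_const {n : ℕ} (Y : Set (Euc n)) (c : ℝ) : YB Y (fun _ => c) |c| := by
  refine ⟨fun _ => c, fun _ => 0, |c|, 0,
    ⟨fun _ => 0, |c|, 0, 0, 0, 0, by simp, by simp, by simp, by simp, ?_, by simp, by simp,
      by simp⟩, ⟨continuousOn_const, le_rfl, by simp⟩, by simp, by simp⟩
  intro x hx
  refine ⟨by simp, ?_⟩
  rw [map_zero]
  exact hasFDerivWithinAt_const _ _ _

lemma memCc.memW {n : ℕ} {Y : Set (Euc n)} (hY : IsClosed Y) {φ : Euc n × Euc n → ℝ}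
    (h : memCc Y φ) : memW Y φ := by
  obtain ⟨hc, K, hK, hz⟩ := h
  refine ⟨hc, ?_⟩
  have hcl : IsClosed (pts Y) := hY.prod isClosed_sphere
  have hcont : ContinuousOn (fun x : Euc n × Euc n => wWeight n x.1 * |φ x|) (pts Y) := by
    refine ContinuousOn.mul ?_ hc.abs
    unfold wWeight
    fun_prop
  obtain ⟨M, hM⟩ := ((hK.inter_right hcl).image_of_continuousOn
    (hcont.mono inter_subset_right)).bddAbove
  refine ⟨max M 0, fun x hx => ?_⟩
  by_cases hxK : x ∈ K
  · exact le_max_of_le_left (hM ⟨x, ⟨hxK, hx⟩, rfl⟩)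
  · simp [hz x hx hxK]

lemma memW.memYp {n : ℕ} {Y : Set (Euc n)} {φ : Euc n × Euc n → ℝ}
    (h : memW Y φ) : memYp Y φ := by
  obtain ⟨a, _, _, _, h1, _, _, _⟩ := YB_const Y 0
  have := YB_const Y 0
  refine ⟨fun _ => 0, φ, XB.memX (r := 0) ?_, h, by simp⟩
  refine ⟨fun _ => 0, 0, 0, 0, 0, 0, by simp, by simp, by simp, by simp, ?_, by simp, by simp,
      by simp⟩
  intro x hx
  refine ⟨by simp, ?_⟩
  rw [map_zero]
  exact hasFDerivWithinAt_const _ _ _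

lemma memCc.sub_memYp {n : ℕ} {Y : Set (Euc n)} (hY : IsClosed Y) {φ ψ : Euc n × Euc n → ℝ}
    (h : memCc Y φ) (h' : memYp Y ψ) : memYp Y (fun x => ψ x - φ x) := by
  have := h'.add' ((YB_const Y (-1)).memYp.mul' (h.memW hY).memYp)
  simpa [sub_eq_add_neg] using this

lemma memY0.mul' {n : ℕ} {Y : Set (Euc n)} (hY : IsClosed Y) {φ ψ : Euc n × Euc n → ℝ}
    (h : memY0 Y φ) (h' : memYp Y ψ) : memY0 Y (fun x => φ x * ψ x) := by
  refine ⟨h.1.mul' h', fun ε hε => ?_⟩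
  set R := YNorm Y ψ + 1 with hR
  have hR0 : 0 < R := by have := YNorm_nonneg' Y ψ; linarith
  obtain ⟨χ, hχ, hlt⟩ := h.2 (ε / (2 * R)) (by positivity)
  refine ⟨fun x => χ x * ψ x, ⟨hχ.1.mul h'.continuousOn, ?_⟩, ?_⟩
  · obtain ⟨K, hK, hz⟩ := hχ.2
    exact ⟨K, hK, fun x hx hxK => by simp [hz x hx hxK]⟩
  · have h1 := ((hχ.sub_memYp hY h.1).YB hlt).mul' (h'.YB (r := R) (lt_add_one _))
    have h2 : YB Y (fun x => φ x * ψ x - χ x * ψ x) (ε / (2 * R) * R) :=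
      h1.congr' fun x _ => by ring
    have h3 := h2.YNorm_le
    have : ε / (2 * R) * R = ε / 2 := by field_simp
    linarith

lemma memY0.add' {n : ℕ} {Y : Set (Euc n)} (hY : IsClosed Y) {φ ψ : Euc n × Euc n → ℝ}
    (h : memY0 Y φ) (h' : memY0 Y ψ) : memY0 Y (fun x => φ x + ψ x) := by
  refine ⟨h.1.add' h'.1, fun ε hε => ?_⟩
  obtain ⟨χ, hχ, hlt⟩ := h.2 (ε / 3) (by positivity)
  obtain ⟨χ', hχ', hlt'⟩ := h'.2 (ε / 3) (by positivity)
  refine ⟨fun x => χ x + χ' x, ⟨hχ.1.add hχ'.1, ?_⟩, ?_⟩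
  · obtain ⟨K, hK, hz⟩ := hχ.2
    obtain ⟨K', hK', hz'⟩ := hχ'.2
    refine ⟨K ∪ K', hK.union hK', fun x hx hxK => ?_⟩
    rw [mem_union, not_or] at hxK
    simp [hz x hx hxK.1, hz' x hx hxK.2]
  · have h1 := ((hχ.sub_memYp hY h.1).YB hlt).add' ((hχ'.sub_memYp hY h'.1).YB hlt')
    have h2 : YB Y (fun x => φ x + ψ x - (χ x + χ' x)) (ε / 3 + ε / 3) :=
      h1.congr' fun x _ => by ring
    have h3 := h2.YNorm_le
    linarith

lemma memY.memYp {n : ℕ} {Y : Set (Euc n)} {ψ : Euc n × Euc n → ℝ}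
    (h : memY Y ψ) : memYp Y ψ := by
  obtain ⟨c, φ, h1, h2⟩ := h
  exact (((YB_const Y c).add' (h1.1.YB (lt_add_one _))).congr' h2).memYp

/-- For `n ≥ 2` and `Y ⊆ ℝ^{n+1}` unbounded and closed, `𝔜(Y)` is an
algebra under pointwise multiplication and `‖ψ₁ψ₂‖_𝔜 ≤ ‖ψ₁‖_𝔜 ‖ψ₂‖_𝔜`. -/
theorem YSpace_algebra
    (n : ℕ) (hn : 2 ≤ n) (Y : Set (Euc n)) (hYclosed : IsClosed Y)
    (hYunbounded : ¬ Bornology.IsBounded Y)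
    (ψ₁ ψ₂ : Euc n × Euc n → ℝ) (h₁ : memY Y ψ₁) (h₂ : memY Y ψ₂) :
    memY Y (fun x => ψ₁ x * ψ₂ x) ∧
    YNorm Y (fun x => ψ₁ x * ψ₂ x) ≤ YNorm Y ψ₁ * YNorm Y ψ₂ := by
  have m₁ := h₁.memYp
  have m₂ := h₂.memYp
  constructor
  · obtain ⟨c₁, φ₁, a₁, e₁⟩ := h₁
    obtain ⟨c₂, φ₂, a₂, e₂⟩ := h₂
    refine ⟨c₁ * c₂, _, (a₂.mul' hYclosed (YB_const Y c₁).memYp).add' hYclosed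
      (a₁.mul' hYclosed m₂), fun x hx => ?_⟩
    simp only [e₁ x hx, e₂ x hx]
    ring
  · have key : ∀ ε : ℝ, 0 < ε → YNorm Y (fun x => ψ₁ x * ψ₂ x) ≤
        (YNorm Y ψ₁ + ε) * (YNorm Y ψ₂ + ε) := fun ε hε =>
      ((m₁.YB (lt_add_of_pos_right _ hε)).mul' (m₂.YB (lt_add_of_pos_right _ hε))).YNorm_le
    have hc : Tendsto (fun ε : ℝ => (YNorm Y ψ₁ + ε) * (YNorm Y ψ₂ + ε))
        (nhdsWithin 0 (Ioi 0)) (nhds (YNorm Y ψ₁ * YNorm Y ψ₂)) := by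
      have : Continuous (fun ε : ℝ => (YNorm Y ψ₁ + ε) * (YNorm Y ψ₂ + ε)) := by fun_prop
      have := (this.tendsto 0).mono_left (nhdsWithin_le_nhds (s := Ioi 0))
      simpa using this
    exact ge_of_tendsto hc (eventually_nhdsWithin_of_forall fun ε hε => key ε hε)
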